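/- Let ξ be the (1/2,1/2) Bernoulli measure on Ω_2 = {0,1}^ℤ and let ν be a shift-invariant measure on Ω_2 with h_ν(σ) = 0. Then the only joining of ξ and ν is the product measure ξ × ν. -/

import Mathlib

open MeasureTheory Filter

/-- Entropy of a finite collection of sets with respect to a measure. -/
noncomputable def partEntropy {X : Type*} [MeasurableSpace X] (μ : Measure X)
    (P : Finset (Set X)) : ℝ :=
  ∑ A ∈ P, Real.negMulLog (μ A).toReal

/-- `P` is a finite measurable partition of `X` modulo `μ`-null sets. -/
def IsMPartition {X : Type*} [MeasurableSpace X] (μ : Measure X)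
    (P : Finset (Set X)) : Prop :=
  (∀ A ∈ P, MeasurableSet A) ∧ μ ((⋃ A ∈ P, A)ᶜ) = 0 ∧
    ∀ A ∈ P, ∀ B ∈ P, A ≠ B → μ (A ∩ B) = 0

open Classical in
/-- The join `P ∨ f⁻¹P ∨ ⋯ ∨ f⁻⁽ⁿ⁻¹⁾P`. -/
noncomputable def joinPart {X : Type*} (f : X → X) (P : Finset (Set X)) (n : ℕ) :
    Finset (Set X) :=
  (Fintype.piFinset fun _ : Fin n => P).image fun g => ⋂ i : Fin n, f^[(i : ℕ)] ⁻¹' g i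

/-- Kolmogorov–Sinai (measure-theoretic) entropy of `f` with respect to `μ`. -/
noncomputable def ksEntropy {X : Type*} [MeasurableSpace X] (f : X → X) (μ : Measure X) : ℝ :=
  ⨆ P : {P : Finset (Set X) // IsMPartition μ P},
    Filter.limsup (fun n => partEntropy μ (joinPart f P.1 n) / n) Filter.atTop

/-- The two-sided full shift space on two symbols. -/
abbrev Omega2Z := ℤ → Fin 2

/-- The shift map on a two-sided sequence space. -/
def shiftZ {α : Type*} : (ℤ → α) → (ℤ → α) := fun y n => y (n + 1)

/-- `ξ` is the `(1/2, 1/2)` Bernoulli measure on `{0,1}^ℤ`, characterized by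
its values on cylinder sets. -/
def IsBernoulliHalf (ξ : Measure Omega2Z) : Prop :=
  IsProbabilityMeasure ξ ∧
    ∀ (s : Finset ℤ) (v : ℤ → Fin 2),
      ξ {y | ∀ i ∈ s, y i = v i} = (1 / 2 : ENNReal) ^ s.card

open Real in
lemma negMulLog_add_mul_log_le {p q : ℝ} (hp : 0 ≤ p) (hq : 0 ≤ q) (hpq : 0 < p → 0 < q) :
    negMulLog p + p * log q ≤ q - p := by
  rcases hp.eq_or_lt with rfl | hp
  · simpa using hq
  have h := mul_le_mul_of_nonneg_left (log_le_sub_one_of_pos (div_pos (hpq hp) hp)) hp.le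
  rw [log_div (hpq hp).ne' hp.ne', mul_sub, mul_sub, mul_div_cancel₀ _ hp.ne'] at h
  rw [negMulLog]
  linarith

open Real in
lemma eq_of_negMulLog_add_mul_log_eq {p q : ℝ} (hp : 0 ≤ p) (hpq : 0 < p → 0 < q)
    (h : negMulLog p + p * log q = q - p) : p = q := by
  rcases hp.eq_or_lt with rfl | hp
  · simpa using h
  by_contra hne
  have hlt := mul_lt_mul_of_pos_left (log_lt_sub_one_of_pos (div_pos (hpq hp) hp)
    (by rw [ne_eq, div_eq_one_iff_eq hp.ne']; exact Ne.symm hne)) hp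
  rw [log_div (hpq hp).ne' hp.ne', mul_sub, mul_sub, mul_div_cancel₀ _ hp.ne'] at hlt
  rw [negMulLog] at h
  linarith

/-- Gibbs' inequality. -/
lemma sum_negMulLog_le_sum_mul_neg_log {Z : Type*} [Fintype Z] {p q : Z → ℝ}
    (hp : ∀ z, 0 ≤ p z) (hq : ∀ z, 0 ≤ q z) (hpq : ∀ z, 0 < p z → 0 < q z)
    (hp1 : ∑ z, p z = 1) (hq1 : ∑ z, q z ≤ 1) :
    ∑ z, Real.negMulLog (p z) ≤ ∑ z, p z * -Real.log (q z) := by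
  have h := Finset.sum_le_sum fun z (_ : z ∈ Finset.univ) ↦
    negMulLog_add_mul_log_le (hp z) (hq z) (hpq z)
  simp only [Finset.sum_add_distrib, Finset.sum_sub_distrib] at h
  simp only [mul_neg, Finset.sum_neg_distrib]
  linarith

/-- The sum of a function against the law of a finite-valued random variable. -/
lemma sum_measureReal_preimage_mul {Ω Z : Type*} [MeasurableSpace Ω] [Fintype Z]
    [MeasurableSpace Z] [MeasurableSingletonClass Z] (μ : Measure Ω) [IsFiniteMeasure μ]
    {f : Ω → Z} (hf : Measurable f) (F : Z → ℝ) :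
    ∑ z, μ.real (f ⁻¹' {z}) * F z = ∫ ω, F (f ω) ∂μ := by
  rw [← integral_map (f := F) hf.aemeasurable
    (measurable_of_finite F).aestronglyMeasurable, integral_fintype .of_finite]
  exact Finset.sum_congr rfl fun z _ ↦ by
    rw [map_measureReal_apply hf (measurableSet_singleton z), smul_eq_mul]

lemma sum_measureReal_preimage {Ω Z : Type*} [MeasurableSpace Ω] [Fintype Z]
    [MeasurableSpace Z] [MeasurableSingletonClass Z] (μ : Measure Ω) [IsProbabilityMeasure μ]
    {f : Ω → Z} (hf : Measurable f) : ∑ z, μ.real (f ⁻¹' {z}) = 1 := by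
  simpa using sum_measureReal_preimage_mul μ hf fun _ ↦ 1

lemma integral_comp_finite {Ω Ω' Z : Type*} [MeasurableSpace Ω] [MeasurableSpace Ω'] [Finite Z]
    [MeasurableSpace Z] [MeasurableSingletonClass Z] {μ : Measure Ω} {μ' : Measure Ω'}
    {S : Ω → Ω'} (hS : MeasurePreserving S μ μ') {f : Ω' → Z} (hf : Measurable f) (F : Z → ℝ) :
    ∫ ω, F (f (S ω)) ∂μ = ∫ ω, F (f ω) ∂μ' := by
  rw [← hS.map_eq, integral_map (f := fun ω ↦ F (f ω)) hS.measurable.aemeasurable]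
  exact ((measurable_of_finite F).comp hf).aestronglyMeasurable

/-- A stationary finite-valued process of pairs whose first coordinates are uniform on blocks, and
whose second coordinates have entropy rate zero, has independent coordinates. -/
lemma measureReal_pair_eq_of_entropy_rate_zero {Ω A B : Type*} [MeasurableSpace Ω]
    [Fintype A] [MeasurableSpace A] [MeasurableSingletonClass A]
    [Fintype B] [MeasurableSpace B] [MeasurableSingletonClass B]
    {μ : Measure Ω} [IsProbabilityMeasure μ] {S : Ω → Ω} (hS : MeasurePreserving S μ μ)
    {X : Ω → A} (hX : Measurable X) {Y : Ω → B} (hY : Measurable Y)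
    (hunif : ∀ (q : ℕ) (a : Fin q → A),
      μ.real {ω | ∀ j : Fin q, X (S^[j] ω) = a j} ≤ ((Fintype.card A : ℝ)⁻¹) ^ q)
    (hzero : ∀ ε : ℝ, 0 < ε → ∃ q : ℕ, 0 < q ∧
      ∑ b : Fin q → B, Real.negMulLog (μ.real ((fun ω (j : Fin q) ↦ Y (S^[j] ω)) ⁻¹' {b}))
        ≤ ε * q) (a : A) (b : B) :
    μ.real ((fun ω ↦ (X ω, Y ω)) ⁻¹' {(a, b)}) = (Fintype.card A : ℝ)⁻¹ * μ.real (Y ⁻¹' {b}) := by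
  classical
  obtain ⟨ω₀⟩ : Nonempty Ω := nonempty_of_isProbabilityMeasure μ
  have : Nonempty A := ⟨X ω₀⟩
  set c : ℝ := (Fintype.card A : ℝ) with hc
  have hc0 : 0 < c := by rw [hc]; exact_mod_cast Fintype.card_pos
  set V : Ω → A × B := fun ω ↦ (X ω, Y ω) with hV
  have hVm : Measurable V := hX.prodMk hY
  set r : A × B → ℝ := fun z ↦ μ.real (V ⁻¹' {z}) with hr
  set s : B → ℝ := fun b ↦ μ.real (Y ⁻¹' {b}) with hs
  have hr0 : ∀ z, 0 ≤ r z := fun z ↦ measureReal_nonneg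
  have hs0 : ∀ b, 0 ≤ s b := fun b ↦ measureReal_nonneg
  have hrs : ∀ z, r z ≤ s z.2 := fun z ↦ measureReal_mono (by
    rintro ω rfl
    rfl)
  have hsum : ∀ b, ∑ a, r (a, b) = s b := by
    intro b
    have h1 := sum_measureReal_preimage_mul μ hVm fun z ↦ if z.2 = b then (1 : ℝ) else 0
    have h2 := sum_measureReal_preimage_mul μ hY fun z ↦ if z = b then (1 : ℝ) else 0
    rw [← h1, Fintype.sum_prod_type] at h2
    simpa [hr, hs] using h2.symm
  set g : A × B → ℝ := fun z ↦ r z / s z.2 with hg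
  have hg0 : ∀ z, 0 ≤ g z := fun z ↦ div_nonneg (hr0 z) (hs0 _)
  have hg1 : ∀ b, ∑ a, g (a, b) ≤ 1 := by
    intro b
    simp only [hg, ← Finset.sum_div, hsum]
    exact div_self_le_one _
  -- the conditional entropy of `X` given `Y` is at least the one of the uniform law
  have key : Real.log c ≤ ∫ ω, -Real.log (g (V ω)) ∂μ := by
    refine le_of_forall_pos_le_add fun ε hε ↦ ?_
    obtain ⟨q, hq, hH⟩ := hzero ε hε
    set W : Ω → Fin q → A × B := fun ω j ↦ V (S^[j] ω) with hW
    have hWm : Measurable W := measurable_pi_lambda _ fun j ↦ hVm.comp (hS.measurable.iterate j)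
    set U : Ω → Fin q → B := fun ω j ↦ Y (S^[j] ω)
    have hUm : Measurable U := measurable_pi_lambda _ fun j ↦ hY.comp (hS.measurable.iterate j)
    set p : (Fin q → A × B) → ℝ := fun z ↦ μ.real (W ⁻¹' {z})
    set u : (Fin q → B) → ℝ := fun z ↦ μ.real (U ⁻¹' {z})
    have hp0 : ∀ z, 0 ≤ p z := fun z ↦ measureReal_nonneg
    have hu0 : ∀ z, 0 ≤ u z := fun z ↦ measureReal_nonneg
    have hpu : ∀ z, p z ≤ u fun j ↦ (z j).2 := fun z ↦ measureReal_mono (by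
      rintro ω rfl
      rfl)
    have hpr : ∀ z j, p z ≤ r (z j) := fun z j ↦ by
      have : r (z j) = μ.real (S^[j] ⁻¹' (V ⁻¹' {z j})) :=
        ((hS.iterate j).measureReal_preimage
          (hVm (measurableSet_singleton _)).nullMeasurableSet).symm
      rw [this]
      refine measureReal_mono ?_
      rintro ω rfl
      rfl
    have hpg : ∀ z j, 0 < p z → 0 < g (z j) := fun z j h ↦
      div_pos (h.trans_le (hpr z j)) (h.trans_le ((hpr z j).trans (hrs _)))
    have hp1 : ∑ z, p z = 1 := sum_measureReal_preimage μ hWm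
    have hu1 : ∑ z, u z = 1 := sum_measureReal_preimage μ hUm
    have hQ : ∑ z : Fin q → A × B, (u fun j ↦ (z j).2) * ∏ j, g (z j) ≤ 1 := by
      rw [← (Equiv.arrowProdEquivProdArrow (Fin q) (fun _ ↦ A) fun _ ↦ B).symm.sum_comp,
        Fintype.sum_prod_type_right, ← hu1]
      refine Finset.sum_le_sum fun b _ ↦ ?_
      simp only [Equiv.arrowProdEquivProdArrow, Equiv.coe_fn_symm_mk, ← Finset.mul_sum]
      have := Finset.prod_univ_sum (fun _ : Fin q ↦ (Finset.univ : Finset A))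
        fun j a ↦ g (a, b j)
      rw [Fintype.piFinset_univ] at this
      rw [← this]
      exact mul_le_of_le_one_right (hu0 b) (Finset.prod_le_one
        (fun j _ ↦ Finset.sum_nonneg fun a _ ↦ hg0 _) fun j _ ↦ hg1 _)
    have hgibbs := sum_negMulLog_le_sum_mul_neg_log hp0
      (fun z ↦ mul_nonneg (hu0 _) (Finset.prod_nonneg fun j _ ↦ hg0 (z j)))
      (fun z h ↦ mul_pos (h.trans_le (hpu z)) (Finset.prod_pos fun j _ ↦ hpg z j h)) hp1 hQ
    have hlow : q * Real.log c ≤ ∑ z, Real.negMulLog (p z) := by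
      calc q * Real.log c = ∑ z, p z * (q * Real.log c) := by
            rw [← Finset.sum_mul, hp1, one_mul]
        _ ≤ _ := Finset.sum_le_sum fun z _ ↦ by
          rcases (hp0 z).eq_or_lt with h | h
          · simp [← h]
          rw [Real.negMulLog, neg_mul, ← mul_neg]
          refine mul_le_mul_of_nonneg_left ?_ (hp0 z)
          have h1 : p z ≤ c⁻¹ ^ q := (measureReal_mono (by
            rintro ω rfl j
            rfl)).trans (hunif q fun j ↦ (z j).1)
          have := Real.log_le_log h h1
          rw [Real.log_pow, Real.log_inv] at this
          linarith
    have hup : ∑ z, p z * -Real.log ((u fun j ↦ (z j).2) * ∏ j, g (z j))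
        = ∑ b, Real.negMulLog (u b) + q * ∫ ω, -Real.log (g (V ω)) ∂μ := by
      calc _ = ∑ z, p z * (-Real.log (u fun j ↦ (z j).2) + ∑ j, -Real.log (g (z j))) := by
            refine Finset.sum_congr rfl fun z _ ↦ ?_
            rcases (hp0 z).eq_or_lt with h | h
            · simp [← h]
            rw [Real.log_mul (h.trans_le (hpu z)).ne'
              (Finset.prod_pos fun j _ ↦ hpg z j h).ne',
              Real.log_prod fun j _ ↦ (hpg z j h).ne', neg_add, Finset.sum_neg_distrib]
        _ = ∫ ω, -Real.log (u (U ω)) ∂μ + ∑ j : Fin q, ∫ ω, -Real.log (g (V (S^[j] ω))) ∂μ := by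
            simp only [mul_add, Finset.sum_add_distrib, Finset.mul_sum]
            rw [Finset.sum_comm]
            congr 1
            · exact sum_measureReal_preimage_mul μ hWm fun z ↦ -Real.log (u fun j ↦ (z j).2)
            · exact Finset.sum_congr rfl fun j _ ↦
                sum_measureReal_preimage_mul μ hWm fun z ↦ -Real.log (g (z j))
        _ = _ := by
            congr 1
            · rw [← sum_measureReal_preimage_mul μ hUm fun z ↦ -Real.log (u z)]
              exact Finset.sum_congr rfl fun z _ ↦ by rw [Real.negMulLog, mul_neg, neg_mul]
            · rw [Finset.sum_congr rfl fun (j : Fin q) _ ↦ integral_comp_finite (hS.iterate j) hVm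
                fun z ↦ -Real.log (g z)]
              simp
    have hq' : (0 : ℝ) < q := by exact_mod_cast hq
    rw [← mul_le_mul_iff_right₀ hq', mul_add]
    linarith
  have hrle : ∀ z, 0 ≤ (c⁻¹ * s z.2 - r z) - (Real.negMulLog (r z) +
      r z * Real.log (c⁻¹ * s z.2)) := fun z ↦ sub_nonneg.2 <|
    negMulLog_add_mul_log_le (hr0 z) (mul_nonneg (inv_nonneg.2 hc0.le) (hs0 _)) fun h ↦
      mul_pos (inv_pos.2 hc0) (h.trans_le (hrs z))
  have hr1 : ∑ z, r z = 1 := sum_measureReal_preimage μ hVm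
  have hs1 : ∑ z : A × B, c⁻¹ * s z.2 = 1 := by
    rw [Fintype.sum_prod_type]
    simp only [← Finset.mul_sum, hs, sum_measureReal_preimage μ hY, Finset.sum_const,
      Finset.card_univ, nsmul_eq_mul]
    field_simp
    exact hc.symm
  have hlog : ∑ z, (Real.negMulLog (r z) + r z * Real.log (c⁻¹ * s z.2))
      = ∫ ω, -Real.log (g (V ω)) ∂μ - Real.log c := by
    rw [← sum_measureReal_preimage_mul μ hVm fun z ↦ -Real.log (g z)]
    rw [show Real.log c = ∑ z, r z * Real.log c by rw [← Finset.sum_mul, hr1, one_mul],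
      ← Finset.sum_sub_distrib]
    refine Finset.sum_congr rfl fun z _ ↦ ?_
    change _ = r z * -Real.log (r z / s z.2) - _
    rcases (hr0 z).eq_or_lt with h | h
    · simp [← h]
    have hsz := h.trans_le (hrs z)
    rw [Real.negMulLog, Real.log_mul (inv_pos.2 hc0).ne' hsz.ne', Real.log_inv,
      Real.log_div h.ne' hsz.ne']
    ring
  have hsumle : ∑ z, ((c⁻¹ * s z.2 - r z) - (Real.negMulLog (r z) +
      r z * Real.log (c⁻¹ * s z.2))) = 0 := by
    refine le_antisymm ?_ (Finset.sum_nonneg fun z _ ↦ hrle z)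
    rw [Finset.sum_sub_distrib, hlog, Finset.sum_sub_distrib, hs1, hr1]
    linarith
  have := (Finset.sum_eq_zero_iff_of_nonneg fun z _ ↦ hrle z).1 hsumle (a, b) (Finset.mem_univ _)
  exact eq_of_negMulLog_add_mul_log_eq (hr0 (a, b)) (fun h ↦
      mul_pos (inv_pos.2 hc0) (h.trans_le (hrs (a, b)))) (sub_eq_zero.1 this).symm

lemma shiftZ_iterate_apply {α : Type*} (k : ℕ) (y : ℤ → α) (n : ℤ) :
    shiftZ^[k] y n = y (n + k) := by
  induction k generalizing y with
  | zero => simp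
  | succ k ih =>
    rw [Function.iterate_succ_apply, ih, shiftZ]
    congr 1
    push_cast
    ring

lemma measurable_shiftZ {α : Type*} [MeasurableSpace α] :
    Measurable (shiftZ : (ℤ → α) → ℤ → α) :=
  measurable_pi_lambda _ fun _ ↦ measurable_pi_apply _

/-- The index of a set of the family `t` containing the given point, if there is one. -/
noncomputable def selectIndex {Ω K : Type*} [Nonempty K] (t : K → Set Ω) (ω : Ω) : K :=
  Classical.epsilon fun k ↦ ω ∈ t k

lemma mem_selectIndex {Ω K : Type*} [Nonempty K] {t : K → Set Ω} {ω : Ω} {k : K}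
    (h : ω ∈ t k) : ω ∈ t (selectIndex t ω) :=
  Classical.epsilon_spec (p := fun k ↦ ω ∈ t k) ⟨k, h⟩

lemma measurable_selectIndex {Ω K : Type*} [MeasurableSpace Ω] [Finite K] [Nonempty K]
    [MeasurableSpace K] {t : K → Set Ω} (ht : ∀ k, MeasurableSet (t k)) :
    Measurable (selectIndex t) := by
  have h : Measurable fun ω k ↦ ω ∈ t k :=
    measurable_pi_lambda _ fun k ↦ measurableSet_setOfPred.1 (ht k)
  exact (measurable_of_finite fun f : K → Prop ↦ Classical.epsilon f).comp h

/-- A finite-valued measurable function on a sequence space is approximated by one which depends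
on finitely many coordinates. -/
lemma exists_dependsOn_measureReal_ne_le {K : Type*} [Fintype K] [Nonempty K] [MeasurableSpace K]
    [MeasurableSingletonClass K] (ν : Measure Omega2Z) [IsProbabilityMeasure ν]
    {G : Omega2Z → K} (hG : Measurable G) {ε : ℝ} (hε : 0 < ε) :
    ∃ (N : ℕ) (Φ : Omega2Z → K), Measurable Φ ∧ DependsOn Φ (Set.Icc (-N : ℤ) N) ∧
      ν.real {y | G y ≠ Φ y} ≤ ε := by
  have hδ : 0 < ENNReal.ofReal (ε / Fintype.card K) :=
    ENNReal.ofReal_pos.2 (div_pos hε (by exact_mod_cast Fintype.card_pos))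
  have happrox (k : K) := exists_measure_symmDiff_lt_of_generateFrom_isSetRing (μ := ν)
    (isSetRing_measurableCylinders (α := fun _ : ℤ ↦ Fin 2))
    ⟨{Set.univ}, Set.countable_singleton _,
      Set.singleton_subset_iff.2 (univ_mem_measurableCylinders _), by simp⟩
    generateFrom_measurableCylinders.symm (hG (measurableSet_singleton k)) hδ
  choose t ht htlt using happrox
  choose s S hS hts using fun k ↦ (mem_measurableCylinders (t k)).1 (ht k)
  refine ⟨∑ k, ∑ i ∈ s k, i.natAbs, selectIndex t,
    measurable_selectIndex fun k ↦ .of_mem_measurableCylinders (ht k), ?_, ?_⟩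
  · intro x y hxy
    have hmem : ∀ k, x ∈ t k ↔ y ∈ t k := by
      intro k
      rw [hts k, mem_cylinder, mem_cylinder]
      suffices (s k).restrict x = (s k).restrict y by rw [this]
      funext i
      refine hxy i ?_
      have h1 : (i : ℤ).natAbs ≤ ∑ i ∈ s k, i.natAbs :=
        Finset.single_le_sum (f := Int.natAbs) (fun _ _ ↦ Nat.zero_le _) i.2
      have h2 : ∑ i ∈ s k, i.natAbs ≤ ∑ k, ∑ i ∈ s k, i.natAbs :=
        Finset.single_le_sum (f := fun k ↦ ∑ i ∈ s k, i.natAbs)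
          (fun _ _ ↦ Nat.zero_le _) (Finset.mem_univ k)
      rw [Set.mem_Icc]
      omega
    simp only [selectIndex, hmem]
  · have hsub : {y | G y ≠ selectIndex t y} ⊆ ⋃ k, symmDiff (t k) (G ⁻¹' {k}) := by
      intro y hy
      rw [Set.mem_iUnion]
      by_cases h : y ∈ t (G y)
      · exact ⟨selectIndex t y, Or.inl ⟨mem_selectIndex h, hy⟩⟩
      · exact ⟨G y, Or.inr ⟨rfl, h⟩⟩
    calc ν.real {y | G y ≠ selectIndex t y} ≤ ν.real (⋃ k, symmDiff (t k) (G ⁻¹' {k})) :=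
          measureReal_mono hsub
      _ ≤ ∑ k, ν.real (symmDiff (t k) (G ⁻¹' {k})) := measureReal_iUnion_fintype_le _
      _ ≤ ∑ _k : K, ε / Fintype.card K := Finset.sum_le_sum fun k _ ↦
          ENNReal.toReal_le_of_le_ofReal (by positivity) (htlt k).le
      _ = ε := by
        rw [Finset.sum_const, Finset.card_univ, nsmul_eq_mul]
        field_simp

lemma integrable_comp_finite {Ω Z : Type*} [MeasurableSpace Ω] [Finite Z]
    [MeasurableSpace Z] [MeasurableSingletonClass Z] (μ : Measure Ω) [IsFiniteMeasure μ]
    {f : Ω → Z} (hf : Measurable f) (F : Z → ℝ) : Integrable (fun ω ↦ F (f ω)) μ :=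
  (Integrable.of_finite (μ := μ.map f) (f := F)).comp_measurable hf

/-- The entropy of the `n`-block law of a stationary process which is close to a process depending
on finitely many coordinates. -/
lemma sum_negMulLog_block_le {K : Type*} [Fintype K] [Nonempty K] [MeasurableSpace K]
    [MeasurableSingletonClass K] {ν : Measure Omega2Z} [IsProbabilityMeasure ν]
    (hν : MeasurePreserving shiftZ ν ν) {G Φ : Omega2Z → K} (hG : Measurable G)
    (hΦ : Measurable Φ) {N : ℕ} (hdep : DependsOn Φ (Set.Icc (-N : ℤ) N)) (n : ℕ) :
    ∑ g : Fin n → K, Real.negMulLog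
        (ν.real ((fun y (j : Fin n) ↦ G (shiftZ^[j] y)) ⁻¹' {g})) ≤
      (n + 2 * N + 1) * Real.log 2 +
        n * (Real.log 2 + ν.real {y | G y ≠ Φ y} * Real.log (Fintype.card K)) := by
  classical
  set W : Omega2Z → Fin n → K := fun y j ↦ G (shiftZ^[j] y) with hW
  have hWm : Measurable W := measurable_pi_lambda _ fun j ↦ hG.comp (hν.measurable.iterate j)
  set c : ℝ := (Fintype.card K : ℝ) with hc
  have hc0 : 0 < c := by rw [hc]; exact_mod_cast Fintype.card_pos
  set k : K × K → ℝ := fun z ↦ if z.1 = z.2 then 2⁻¹ else (2 * c)⁻¹ with hk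
  have hk0 : ∀ z, 0 < k z := fun z ↦ by simp only [hk]; split_ifs <;> positivity
  have hk1 : ∀ b, ∑ a, k (a, b) ≤ 1 := by
    intro b
    calc ∑ a, k (a, b) ≤ ∑ a, ((if a = b then 2⁻¹ else 0) + (2 * c)⁻¹) :=
          Finset.sum_le_sum fun a _ ↦ by
            simp only [hk]
            split_ifs
            · have : 0 < (2 * c)⁻¹ := by positivity
              linarith
            · simp
      _ = 1 := by
        rw [Finset.sum_add_distrib, Finset.sum_ite_eq' Finset.univ b, Finset.sum_const,
          Finset.card_univ, nsmul_eq_mul, ← hc, if_pos (Finset.mem_univ b)]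
        field_simp
        norm_num
  set F : Finset ℤ := Finset.Icc (-N : ℤ) (N + n) with hF
  have hFcard : F.card = n + 2 * N + 1 := by
    rw [hF, Int.card_Icc]
    omega
  set e : (F → Fin 2) → Omega2Z := fun z i ↦ if h : i ∈ F then z ⟨i, h⟩ else 0 with he
  have hext : ∀ y (j : Fin n), Φ (shiftZ^[j] (e (F.restrict y))) = Φ (shiftZ^[j] y) := by
    intro y j
    refine hdep fun i hi ↦ ?_
    have hj := j.2
    rw [Set.mem_Icc] at hi
    have : i + (j : ℕ) ∈ F := by
      rw [hF, Finset.mem_Icc]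
      omega
    simp [shiftZ_iterate_apply, he, this]
  set q : (Fin n → K) → ℝ := fun g ↦
    ∑ z : F → Fin 2, (2 ^ F.card)⁻¹ * ∏ j : Fin n, k (g j, Φ (shiftZ^[j] (e z)))
  have hqpos : ∀ g, 0 < q g := fun g ↦ Finset.sum_pos (fun z _ ↦ mul_pos (by positivity)
    (Finset.prod_pos fun j _ ↦ hk0 _)) Finset.univ_nonempty
  have hq1 : ∑ g, q g ≤ 1 := by
    rw [Finset.sum_comm]
    calc _ ≤ ∑ _z : F → Fin 2, ((2 : ℝ) ^ F.card)⁻¹ := Finset.sum_le_sum fun z _ ↦ by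
          rw [← Finset.mul_sum]
          have := Finset.prod_univ_sum (fun _ : Fin n ↦ (Finset.univ : Finset K))
            fun j a ↦ k (a, Φ (shiftZ^[j] (e z)))
          rw [Fintype.piFinset_univ] at this
          rw [← this]
          exact mul_le_of_le_one_right (by positivity) (Finset.prod_le_one
            (fun j _ ↦ Finset.sum_nonneg fun a _ ↦ (hk0 _).le) fun j _ ↦ hk1 _)
      _ = 1 := by simp
  have hlogq : ∀ y, -Real.log (q (W y)) ≤ (n + 2 * N + 1) * Real.log 2 +
      ∑ j : Fin n, -Real.log (k (G (shiftZ^[j] y), Φ (shiftZ^[j] y))) := by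
    intro y
    have hle : (2 ^ F.card)⁻¹ * ∏ j : Fin n, k (G (shiftZ^[j] y), Φ (shiftZ^[j] y)) ≤ q (W y) := by
      refine le_of_eq_of_le ?_ (Finset.single_le_sum (fun z _ ↦ mul_nonneg (by positivity)
        (Finset.prod_nonneg fun j _ ↦ (hk0 _).le)) (Finset.mem_univ (F.restrict y)))
      simp only [hext, hW]
    have hprod : 0 < ∏ j : Fin n, k (G (shiftZ^[j] y), Φ (shiftZ^[j] y)) :=
      Finset.prod_pos fun j _ ↦ hk0 _
    have := Real.log_le_log (mul_pos (by positivity) hprod) hle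
    rw [Real.log_mul (by positivity) hprod.ne', Real.log_inv, Real.log_pow, hFcard,
      Real.log_prod fun j _ ↦ (hk0 _).ne'] at this
    push_cast at this
    rw [Finset.sum_neg_distrib]
    linarith
  have hGΦ : Measurable fun y ↦ (G y, Φ y) := hG.prodMk hΦ
  have hlogk : ∫ y, -Real.log (k (G y, Φ y)) ∂ν
      = Real.log 2 + ν.real {y | G y ≠ Φ y} * Real.log c := by
    have hmeas : MeasurableSet {y | G y ≠ Φ y} := (measurableSet_eq_fun hG hΦ).compl
    have heq : ∀ y, -Real.log (k (G y, Φ y))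
        = Real.log 2 + {y | G y ≠ Φ y}.indicator (fun _ ↦ Real.log c) y := by
      intro y
      by_cases h : G y = Φ y
      · simp [hk, h]
      · have : -Real.log (2 * c)⁻¹ = Real.log 2 + Real.log c := by
          rw [Real.log_inv, neg_neg, Real.log_mul two_ne_zero hc0.ne']
        simpa [hk, h] using this
    simp_rw [heq]
    rw [integral_add (integrable_const _) ((integrable_const _).indicator hmeas),
      integral_indicator_const _ hmeas]
    simp
  have hint (j : Fin n) : Integrable
      (fun y ↦ -Real.log (k (G (shiftZ^[j] y), Φ (shiftZ^[j] y)))) ν :=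
    integrable_comp_finite ν (hGΦ.comp (hν.measurable.iterate j)) fun z ↦ -Real.log (k z)
  calc _ ≤ ∑ g, ν.real (W ⁻¹' {g}) * -Real.log (q g) :=
        sum_negMulLog_le_sum_mul_neg_log (fun _ ↦ measureReal_nonneg) (fun g ↦ (hqpos g).le)
          (fun g _ ↦ hqpos g) (sum_measureReal_preimage ν hWm) hq1
    _ = ∫ y, -Real.log (q (W y)) ∂ν := sum_measureReal_preimage_mul ν hWm fun g ↦ -Real.log (q g)
    _ ≤ ∫ y, ((n + 2 * N + 1) * Real.log 2 +
          ∑ j : Fin n, -Real.log (k (G (shiftZ^[j] y), Φ (shiftZ^[j] y)))) ∂ν :=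
        integral_mono (integrable_comp_finite ν hWm fun g ↦ -Real.log (q g))
          ((integrable_const _).add (integrable_finsetSum _ fun j _ ↦ hint j)) hlogq
    _ = _ := by
      rw [integral_add (integrable_const _) (integrable_finsetSum _ fun j _ ↦ hint j),
        integral_finsetSum _ fun j _ ↦ hint j,
        Finset.sum_congr rfl fun (j : Fin n) _ ↦ integral_comp_finite (hν.iterate j) hGΦ
          fun z ↦ -Real.log (k z), hlogk]
      simp [mul_add]

lemma joinPart_eq_image {X : Type*} [DecidableEq (Set X)] (f : X → X) (P : Finset (Set X))
    (n : ℕ) : joinPart f P n =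
      Finset.univ.image fun g : Fin n → P ↦ ⋂ i : Fin n, f^[i] ⁻¹' (g i : Set X) := by
  ext A
  simp only [joinPart, Finset.mem_image, Fintype.mem_piFinset, Finset.mem_univ, true_and]
  constructor
  · rintro ⟨g, hg, rfl⟩
    exact ⟨fun i ↦ ⟨g i, hg i⟩, rfl⟩
  · rintro ⟨g, rfl⟩
    exact ⟨fun i ↦ g i, fun i ↦ (g i).2, rfl⟩

lemma partEntropy_nonneg {X : Type*} [MeasurableSpace X] (μ : Measure X) [IsProbabilityMeasure μ]
    (P : Finset (Set X)) : 0 ≤ partEntropy μ P :=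
  Finset.sum_nonneg fun _ _ ↦ Real.negMulLog_nonneg measureReal_nonneg measureReal_le_one

lemma partEntropy_joinPart_le {X : Type*} [MeasurableSpace X] (μ : Measure X)
    [IsProbabilityMeasure μ] (f : X → X) (P : Finset (Set X)) (n : ℕ) :
    partEntropy μ (joinPart f P n) ≤
      ∑ g : Fin n → P, Real.negMulLog (μ.real (⋂ i : Fin n, f^[i] ⁻¹' (g i : Set X))) := by
  classical
  rw [joinPart_eq_image, partEntropy]
  exact Finset.sum_image_le_of_nonneg fun _ _ ↦
    Real.negMulLog_nonneg measureReal_nonneg measureReal_le_one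

lemma IsMPartition.nonempty {X : Type*} [MeasurableSpace X] {μ : Measure X} [NeZero μ]
    {P : Finset (Set X)} (hP : IsMPartition μ P) : P.Nonempty := by
  rw [Finset.nonempty_iff_ne_empty]
  rintro rfl
  exact NeZero.ne μ (by simpa using hP.2.1)

lemma IsMPartition.ae_selectIndex_eq_iff {X : Type*} [MeasurableSpace X] {μ : Measure X}
    {P : Finset (Set X)} [Nonempty P] (hP : IsMPartition μ P) :
    ∀ᵐ x ∂μ, ∀ A : P, selectIndex (fun A : P ↦ (A : Set X)) x = A ↔ x ∈ (A : Set X) := by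
  have hcover : ∀ᵐ x ∂μ, x ∈ ⋃ A ∈ P, A := hP.2.1
  have hdisj : ∀ᵐ x ∂μ, ∀ A B : P, A ≠ B → x ∉ (A ∩ B : Set X) := by
    simp only [ae_all_iff]
    intro A B hAB
    exact measure_eq_zero_iff_ae_notMem.1 (hP.2.2 A A.2 B B.2 (Subtype.coe_ne_coe.2 hAB))
  filter_upwards [hcover, hdisj] with x hx hd A
  obtain ⟨B, hB, hxB⟩ := Set.mem_iUnion₂.1 hx
  have hmem := mem_selectIndex (t := fun A : P ↦ (A : Set X)) (k := ⟨B, hB⟩) hxB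
  refine ⟨fun h ↦ h ▸ hmem, fun h ↦ ?_⟩
  by_contra hne
  exact hd _ _ hne ⟨hmem, h⟩

/-- The entropy of the full two-shift is finite. -/
lemma eventually_partEntropy_joinPart_div_le {ν : Measure Omega2Z} [IsProbabilityMeasure ν]
    (hν : MeasurePreserving shiftZ ν ν) {P : Finset (Set Omega2Z)} (hP : IsMPartition ν P) :
    ∀ᶠ n : ℕ in atTop, partEntropy ν (joinPart shiftZ P n) / n ≤ 3 * Real.log 2 + 1 := by
  have : Nonempty P := hP.nonempty.to_subtype
  let : MeasurableSpace P := ⊤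
  have hlog : 0 ≤ Real.log (Fintype.card P) := Real.log_natCast_nonneg _
  set G : Omega2Z → P := selectIndex fun A : P ↦ (A : Set Omega2Z)
  have hG : Measurable G := measurable_selectIndex fun A ↦ hP.1 A A.2
  obtain ⟨N, Φ, hΦ, hdep, hne⟩ := exists_dependsOn_measureReal_ne_le ν hG
    (inv_pos.2 (by linarith : 0 < 1 + Real.log (Fintype.card P)))
  filter_upwards [eventually_ge_atTop (2 * N + 1)] with n hn
  have hn0 : (0 : ℝ) < n := by exact_mod_cast (by omega : 0 < n)
  have hn' : (2 * N + 1 : ℝ) ≤ n := by exact_mod_cast hn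
  have hatom (g : Fin n → P) : ν.real (⋂ i : Fin n, shiftZ^[i] ⁻¹' (g i : Set Omega2Z))
      = ν.real ((fun y (j : Fin n) ↦ G (shiftZ^[j] y)) ⁻¹' {g}) := by
    refine measureReal_congr ?_
    have hae : ∀ᵐ y ∂ν, ∀ j : Fin n, ∀ A : P,
        G (shiftZ^[j] y) = A ↔ shiftZ^[j] y ∈ (A : Set Omega2Z) :=
      ae_all_iff.2 fun j ↦ (hν.iterate j).quasiMeasurePreserving.ae hP.ae_selectIndex_eq_iff
    filter_upwards [hae] with y hy
    refine propext ?_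
    change y ∈ (⋂ i : Fin n, shiftZ^[i] ⁻¹' (g i : Set Omega2Z)) ↔
      (fun j : Fin n ↦ G (shiftZ^[j] y)) = g
    simp only [Set.mem_iInter, Set.mem_preimage, funext_iff, hy]
  have hbound := sum_negMulLog_block_le hν hG hΦ hdep n
  simp only [← hatom] at hbound
  have hmul : ν.real {y | G y ≠ Φ y} * Real.log (Fintype.card P) ≤ 1 := by
    calc _ ≤ (1 + Real.log (Fintype.card P))⁻¹ * Real.log (Fintype.card P) := by gcongr
      _ ≤ 1 := by
        rw [inv_mul_le_iff₀ (by linarith)]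
        linarith
  rw [div_le_iff₀ hn0]
  have hlog2 := Real.log_pos one_lt_two
  calc _ ≤ _ := (partEntropy_joinPart_le ν shiftZ P n).trans hbound
    _ ≤ (n + n) * Real.log 2 + n * (Real.log 2 + 1) := by
      gcongr ?_ * _ + _ * (_ + ?_)
      linarith
    _ = _ := by ring

lemma limsup_partEntropy_joinPart_le_ksEntropy {ν : Measure Omega2Z} [IsProbabilityMeasure ν]
    (hν : MeasurePreserving shiftZ ν ν) {P : Finset (Set Omega2Z)} (hP : IsMPartition ν P) :
    limsup (fun n : ℕ ↦ partEntropy ν (joinPart shiftZ P n) / n) atTop ≤ ksEntropy shiftZ ν := by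
  refine le_ciSup (f := fun P : {P : Finset (Set Omega2Z) // IsMPartition ν P} ↦
    limsup (fun n : ℕ ↦ partEntropy ν (joinPart shiftZ P.1 n) / n) atTop) ?_ ⟨P, hP⟩
  refine ⟨3 * Real.log 2 + 1, ?_⟩
  rintro _ ⟨Q, rfl⟩
  refine limsup_le_of_le ?_ (eventually_partEntropy_joinPart_div_le hν Q.2)
  exact isCoboundedUnder_le_of_le atTop (x := 0) fun n ↦
    div_nonneg (partEntropy_nonneg ν _) n.cast_nonneg

/-- The partition of `{0,1}^ℤ` according to the zeroth coordinate. -/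
noncomputable def coordPart : Finset (Set Omega2Z) :=
  open Classical in Finset.univ.image fun a : Fin 2 ↦ {y : Omega2Z | y 0 = a}

lemma isMPartition_coordPart (ν : Measure Omega2Z) : IsMPartition ν coordPart := by
  refine ⟨?_, ?_, ?_⟩
  · simp only [coordPart, Finset.mem_image, Finset.mem_univ, true_and]
    rintro _ ⟨a, rfl⟩
    exact (measurable_pi_apply (X := fun _ : ℤ ↦ Fin 2) 0) (measurableSet_singleton a)
  · have : ⋃ A ∈ coordPart, A = (Set.univ : Set Omega2Z) := by
      ext y
      simpa [coordPart] using Fin.exists_fin_two.1 ⟨y 0, rfl⟩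
    simp [this]
  · simp only [coordPart, Finset.mem_image, Finset.mem_univ, true_and]
    rintro _ ⟨a, rfl⟩ _ ⟨b, rfl⟩ hab
    have : {y : Omega2Z | y 0 = a} ∩ {y | y 0 = b} = ∅ := by
      ext y
      simp only [Set.mem_inter_iff, Set.mem_ofPred_eq, Set.mem_empty_iff_false, iff_false]
      rintro ⟨rfl, rfl⟩
      exact hab rfl
    simp [this]

lemma partEntropy_joinPart_coordPart (ν : Measure Omega2Z) (n : ℕ) :
    partEntropy ν (joinPart shiftZ coordPart n) =
      ∑ c : Fin n → Fin 2, Real.negMulLog (ν.real {y | ∀ i : Fin n, y (i : ℕ) = c i}) := by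
  classical
  have hjoin : joinPart shiftZ coordPart n = Finset.univ.image
      fun c : Fin n → Fin 2 ↦ {y : Omega2Z | ∀ i : Fin n, y (i : ℕ) = c i} := by
    have hset (c : Fin n → Fin 2) : {y : Omega2Z | ∀ i : Fin n, y (i : ℕ) = c i} =
        ⋂ i : Fin n, shiftZ^[i] ⁻¹' {y | y 0 = c i} := by
      ext y
      simp [shiftZ_iterate_apply]
    ext A
    simp only [joinPart, Finset.mem_image, Fintype.mem_piFinset, Finset.mem_univ, true_and, hset,
      coordPart]
    constructor
    · rintro ⟨g, hg, rfl⟩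
      choose c hc using hg
      exact ⟨c, by simp only [hc]⟩
    · rintro ⟨c, rfl⟩
      exact ⟨fun i ↦ {y | y 0 = c i}, fun i ↦ ⟨c i, rfl⟩, rfl⟩
  rw [partEntropy, hjoin, Finset.sum_image]
  · rfl
  intro c _ d _ hcd
  funext i
  let y : Omega2Z := fun k ↦ if h : k.toNat < n then c ⟨k.toNat, h⟩ else 0
  have hy : y ∈ {y : Omega2Z | ∀ i : Fin n, y (i : ℕ) = c i} := fun i ↦ by simp [y]
  have hy' : y ∈ {y : Omega2Z | ∀ i : Fin n, y (i : ℕ) = d i} := by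
    simp only at hcd
    rwa [← hcd]
  exact (hy i).symm.trans (hy' i)

lemma eventually_partEntropy_coordPart_le {ν : Measure Omega2Z} [IsProbabilityMeasure ν]
    (hν : MeasurePreserving shiftZ ν ν) (h0 : ksEntropy shiftZ ν = 0) {ε : ℝ} (hε : 0 < ε) :
    ∀ᶠ n : ℕ in atTop, partEntropy ν (joinPart shiftZ coordPart n) ≤ ε * n := by
  have hP := isMPartition_coordPart ν
  have hlim := (limsup_partEntropy_joinPart_le_ksEntropy hν hP).trans_lt (h0.trans_lt hε)
  filter_upwards [eventually_lt_of_limsup_lt hlim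
    ⟨_, eventually_map.2 (eventually_partEntropy_joinPart_div_le hν hP)⟩,
    eventually_gt_atTop 0] with n hn hn0
  rw [div_lt_iff₀ (by exact_mod_cast hn0)] at hn
  exact hn.le

lemma IsBernoulliHalf.measureReal_block {ξ : Measure Omega2Z} (hξ : IsBernoulliHalf ξ) {n : ℕ}
    (c : Fin n → Fin 2) : ξ.real {y | ∀ i : Fin n, y (i : ℕ) = c i} = (2 ^ n)⁻¹ := by
  have hset : {y : Omega2Z | ∀ i : Fin n, y (i : ℕ) = c i} =
      {y | ∀ i ∈ (Finset.range n).map Nat.castEmbedding,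
        y i = if h : i.toNat < n then c ⟨i.toNat, h⟩ else 0} := by
    ext y
    simp only [Set.mem_ofPred_eq, Finset.mem_map, Finset.mem_range, Nat.castEmbedding_apply,
      forall_exists_index, and_imp, forall_apply_eq_imp_iff₂, Int.toNat_natCast]
    refine ⟨fun h i hi ↦ ?_, fun h i ↦ ?_⟩
    · rw [dif_pos hi, ← h ⟨i, hi⟩]
    · rw [h i i.2, dif_pos i.2]
  rw [hset, measureReal_def, hξ.2]
  simp

/-- The first `m` coordinates with nonnegative indices. -/
def block (m : ℕ) (y : Omega2Z) (i : Fin m) : Fin 2 := y (i : ℕ)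

lemma measurable_block (m : ℕ) : Measurable (block m) :=
  measurable_pi_lambda _ fun _ ↦ measurable_pi_apply _

/-- Concatenation of `q` words of length `m`. -/
def concatEquiv (q m : ℕ) : (Fin q → Fin m → Fin 2) ≃ (Fin (q * m) → Fin 2) :=
  (Equiv.curry _ _ _).symm.trans (Equiv.arrowCongr finProdFinEquiv (Equiv.refl _))

lemma forall_block_eq_iff {q m : ℕ} (y : Omega2Z) (a : Fin q → Fin m → Fin 2) :
    (∀ j : Fin q, block m (shiftZ^[m * j] y) = a j) ↔
      ∀ k : Fin (q * m), y (k : ℕ) = concatEquiv q m a k := by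
  rw [finProdFinEquiv.surjective.forall, Prod.forall]
  refine forall_congr' fun j ↦ ?_
  rw [funext_iff]
  refine forall_congr' fun i ↦ ?_
  simp [block, shiftZ_iterate_apply, concatEquiv]

lemma prodMap_shiftZ_iterate (k : ℕ) (ω : Omega2Z × Omega2Z) :
    (Prod.map shiftZ shiftZ)^[k] ω = (shiftZ^[k] ω.1, shiftZ^[k] ω.2) := by
  rw [Prod.map_iterate]
  rfl

lemma indepFun_block {ξ ν : Measure Omega2Z} [IsProbabilityMeasure ν] (hξ : IsBernoulliHalf ξ)
    (hν : MeasurePreserving shiftZ ν ν) (h0 : ksEntropy shiftZ ν = 0)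
    {lam : Measure (Omega2Z × Omega2Z)} [IsProbabilityMeasure lam]
    (hlam : MeasurePreserving (Prod.map shiftZ shiftZ) lam lam)
    (hfst : MeasurePreserving Prod.fst lam ξ) (hsnd : MeasurePreserving Prod.snd lam ν)
    {m : ℕ} (hm : 0 < m) :
    ProbabilityTheory.IndepFun (fun ω ↦ block m ω.1) (fun ω ↦ block m ω.2) lam := by
  have hX : Measurable fun ω : Omega2Z × Omega2Z ↦ block m ω.1 :=
    (measurable_block m).comp measurable_fst
  have hY : Measurable fun ω : Omega2Z × Omega2Z ↦ block m ω.2 :=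
    (measurable_block m).comp measurable_snd
  have hmeas (n : ℕ) (c : Fin n → Fin 2) :
      MeasurableSet {y : Omega2Z | ∀ i : Fin n, y (i : ℕ) = c i} := by
    have : {y : Omega2Z | ∀ i : Fin n, y (i : ℕ) = c i} = block n ⁻¹' {c} := by
      ext y
      exact funext_iff.symm
    exact this ▸ measurable_block n (measurableSet_singleton c)
  have hcard : (Fintype.card (Fin m → Fin 2) : ℝ)⁻¹ = (2 ^ m)⁻¹ := by simp
  have hXlaw (a : Fin m → Fin 2) :
      lam.real ((fun ω ↦ block m ω.1) ⁻¹' {a}) = (2 ^ m)⁻¹ := by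
    rw [← hξ.measureReal_block a, ← hfst.measureReal_preimage (hmeas m a).nullMeasurableSet]
    congr 1
    ext ω
    exact funext_iff
  have hpair := measureReal_pair_eq_of_entropy_rate_zero (hlam.iterate m) hX hY
    (fun q a ↦ by
      have : {ω : Omega2Z × Omega2Z |
          ∀ j : Fin q, block m (((Prod.map shiftZ shiftZ)^[m])^[j] ω).1 = a j} =
          Prod.fst ⁻¹' {y | ∀ k : Fin (q * m), y (k : ℕ) = concatEquiv q m a k} := by
        ext ω
        simp only [Set.mem_ofPred_eq, Set.mem_preimage, ← forall_block_eq_iff,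
          ← Function.iterate_mul, prodMap_shiftZ_iterate]
      rw [this, hfst.measureReal_preimage (hmeas _ _).nullMeasurableSet, hξ.measureReal_block,
        hcard, inv_pow, ← pow_mul, mul_comm])
    (fun ε hε ↦ by
      obtain ⟨n, hn⟩ := eventually_atTop.1 (eventually_partEntropy_coordPart_le hν h0
        (div_pos hε (Nat.cast_pos.2 hm)))
      refine ⟨n + 1, n.succ_pos, ?_⟩
      have hle := hn ((n + 1) * m) (by nlinarith)
      rw [partEntropy_joinPart_coordPart] at hle
      refine le_of_eq_of_le (Fintype.sum_equiv (concatEquiv (n + 1) m) _ _ fun b ↦ ?_)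
        (hle.trans_eq ?_)
      · rw [← hsnd.measureReal_preimage (hmeas _ _).nullMeasurableSet]
        congr 2
        ext ω
        simp only [Set.mem_ofPred_eq, Set.mem_preimage, ← forall_block_eq_iff,
          ← Function.iterate_mul, prodMap_shiftZ_iterate, Set.mem_singleton_iff, funext_iff]
      · push_cast
        field_simp)
  rw [ProbabilityTheory.indepFun_iff_map_prod_eq_prod_map_map hX.aemeasurable hY.aemeasurable]
  refine Measure.ext_of_singleton fun ⟨a, b⟩ ↦ ?_
  rw [Measure.map_apply (hX.prodMk hY) (measurableSet_singleton _), ← Set.singleton_prod_singleton,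
    Measure.prod_prod, Measure.map_apply hX (measurableSet_singleton _),
    Measure.map_apply hY (measurableSet_singleton _),
    ← ENNReal.toReal_eq_toReal_iff' (measure_ne_top _ _)
      (ENNReal.mul_ne_top (measure_ne_top _ _) (measure_ne_top _ _)), ENNReal.toReal_mul,
    Set.singleton_prod_singleton]
  have := hpair a b
  rw [hcard, ← hXlaw a] at this
  exact this

/-- Disjointness of the Bernoulli shift from zero-entropy systems: the only
joining of the `(1/2,1/2)` Bernoulli measure `ξ` with a zero-entropy
shift-invariant measure `ν` is the product measure `ξ × ν`. -/
theorem bernoulli_disjoint_zero_entropy (ξ ν : Measure Omega2Z)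
    [IsProbabilityMeasure ν] (hξ : IsBernoulliHalf ξ)
    (hξinv : ξ.map shiftZ = ξ) (hνinv : ν.map shiftZ = ν)
    (hν : ksEntropy shiftZ ν = 0)
    (lam : Measure (Omega2Z × Omega2Z)) [IsProbabilityMeasure lam]
    (hlaminv : lam.map (Prod.map shiftZ shiftZ) = lam)
    (hfst : lam.map Prod.fst = ξ) (hsnd : lam.map Prod.snd = ν) :
    lam = ξ.prod ν := by
  have hlam : MeasurePreserving (Prod.map shiftZ shiftZ) lam lam :=
    ⟨measurable_shiftZ.prodMap measurable_shiftZ, hlaminv⟩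
  have hindep : ProbabilityTheory.IndepFun (Prod.fst : Omega2Z × Omega2Z → Omega2Z)
      (Prod.snd : Omega2Z × Omega2Z → Omega2Z) lam := by
    refine ProbabilityTheory.IndepFun.process_indepFun_process
      (X := fun (i : ℤ) (ω : Omega2Z × Omega2Z) ↦ ω.1 i)
      (Y := fun (i : ℤ) (ω : Omega2Z × Omega2Z) ↦ ω.2 i)
      (fun i ↦ (measurable_pi_apply i).comp measurable_fst)
      (fun i ↦ (measurable_pi_apply i).comp measurable_snd) fun I J ↦ ?_
    set k : ℕ := ∑ i ∈ I, i.natAbs + ∑ i ∈ J, i.natAbs with hk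
    have hI : ∀ i ∈ I, i.natAbs ≤ k := fun i hi ↦ Nat.le_add_right_of_le <|
      Finset.single_le_sum (f := Int.natAbs) (fun _ _ ↦ Nat.zero_le _) hi
    have hJ : ∀ i ∈ J, i.natAbs ≤ k := fun i hi ↦ Nat.le_add_left_of_le <|
      Finset.single_le_sum (f := Int.natAbs) (fun _ _ ↦ Nat.zero_le _) hi
    have hblock := indepFun_block hξ ⟨measurable_shiftZ, hνinv⟩ hν hlam ⟨measurable_fst, hfst⟩
      ⟨measurable_snd, hsnd⟩ (2 * k).succ_pos
    -- the coordinates in a set of integers bounded by `k`, read off the shifted block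
    let read (s : Finset ℤ) (hs : ∀ i ∈ s, i.natAbs ≤ k) (z : Fin (2 * k + 1) → Fin 2) (i : s) :
        Fin 2 := z ⟨((i : ℤ) + k).toNat, by have := hs i i.2; omega⟩
    have hread (s : Finset ℤ) (hs : ∀ i ∈ s, i.natAbs ≤ k) (y : Omega2Z) :
        read s hs (block (2 * k + 1) y) = fun i : s ↦ (shiftZ^[k] y) i := by
      funext i
      have := hs i i.2
      simp only [read, block, shiftZ_iterate_apply]
      congr 1
      omega
    have hcomp : ProbabilityTheory.IndepFun
        ((fun (ω : Omega2Z × Omega2Z) (i : I) ↦ ω.1 i) ∘ (Prod.map shiftZ shiftZ)^[k])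
        ((fun (ω : Omega2Z × Omega2Z) (j : J) ↦ ω.2 j) ∘ (Prod.map shiftZ shiftZ)^[k]) lam := by
      convert! hblock.comp (measurable_of_finite (read I hI))
        (measurable_of_finite (read J hJ)) using 1 <;>
      · funext ω
        simp only [Function.comp_apply, prodMap_shiftZ_iterate, hread]
    have hT := hlam.iterate k
    rw [← hT.map_eq, ProbabilityTheory.indepFun_iff_map_prod_eq_prod_map_map (by fun_prop)
      (by fun_prop), Measure.map_map (by fun_prop) hT.measurable,
      Measure.map_map (by fun_prop) hT.measurable, Measure.map_map (by fun_prop) hT.measurable]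
    exact (ProbabilityTheory.indepFun_iff_map_prod_eq_prod_map_map
      (Measurable.comp (by fun_prop) hT.measurable).aemeasurable
      (Measurable.comp (by fun_prop) hT.measurable).aemeasurable).1 hcomp
  have := (ProbabilityTheory.indepFun_iff_map_prod_eq_prod_map_map
    measurable_fst.aemeasurable measurable_snd.aemeasurable).1 hindep
  rw [hfst, hsnd] at this
  rw [← this]
  exact Measure.map_id.symm
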